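/- arXiv:0908.3866 — 15 statements merged into one kernel-verified Lean document; each statement's English description precedes it below -/
import Mathlib

section
/- Let k ≥ 2 and d be positive integers with 2 ≤ d ≤ 3, and let d_{k,4} = d·(4^k − 1)/3 (the number with k base-4 digits all equal to d). Then (d^k)^2 + (d_{k,4})^2 is not a perfect square; i.e., there is no Pythagorean triangle whose two legs have lengths d^k and d_{k,4}. -/
theorem aux_growth (k : ℕ) (hk : 4 ≤ k) : 3 * k * (3 * k + 2 * 4 ^ k) < 9 ^ k := by
  induction k, hk using Nat.le_induction with
  | base => norm_num
  | succ n hn ih =>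
    rw [pow_succ, pow_succ]
    have h1 : 3 * (n + 1) ≤ 4 * n := by omega
    have h2 : 3 * (n + 1) + 2 * (4 ^ n * 4) ≤ 6 * (3 * n + 2 * 4 ^ n) := by omega
    have h3 := Nat.mul_le_mul h1 h2
    have h4 : 4 * n * (6 * (3 * n + 2 * 4 ^ n)) = 8 * (3 * n * (3 * n + 2 * 4 ^ n)) := by ring
    omega

theorem aux_dvd (k i : ℕ) (hk : k ≠ 0) (h : 3 ^ i ∣ 4 ^ k - 1) : 3 ^ i ∣ 3 * k := by
  have : Fact (Nat.Prime 3) := ⟨Nat.prime_three⟩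
  have hA : 4 ^ k - 1 ≠ 0 := by
    have : 1 < 4 ^ k := Nat.one_lt_pow hk (by norm_num)
    omega
  have hl := padicValNat.pow_sub_pow (p := 3) (x := 4) (y := 1) (by decide) (by norm_num)
    (by norm_num) (by norm_num) hk
  rw [one_pow] at hl
  rw [padicValNat_dvd_iff_le hA, hl] at h
  rw [padicValNat_dvd_iff_le (by omega), padicValNat.mul (by norm_num) hk]
  simpa using h

/-- Theorem 1 (base 4, Type 2): for `k ≥ 2` and `2 ≤ d ≤ 3`, the sum of squares
`(d^k)^2 + (d_{k,4})^2`, where `d_{k,4} = d·(4^k − 1)/3`, is never a perfect square. -/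
theorem no_type2_base4 (k d : ℕ) (hk : 2 ≤ k) (hd2 : 2 ≤ d) (hd3 : d ≤ 3) :
    ¬ ∃ m : ℕ, (d ^ k) ^ 2 + (d * (4 ^ k - 1) / 3) ^ 2 = m ^ 2 := by
  rintro ⟨m, hm⟩
  obtain rfl | rfl : d = 2 ∨ d = 3 := by omega
  · obtain ⟨n, rfl⟩ : ∃ n, k = n + 1 := ⟨k - 1, by omega⟩
    have hd : 3 ∣ 4 ^ (n + 1) - 1 := by
      simpa using Nat.sub_dvd_pow_sub_pow 4 1 (n + 1)
    obtain ⟨R, hR⟩ := hd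
    have hpos : 1 ≤ 4 ^ n := Nat.one_le_pow _ _ (by norm_num)
    have e1 : 2 * (4 ^ (n + 1) - 1) / 3 = 2 * R := by omega
    rw [e1, ← pow_mul, mul_comm (n + 1) 2, pow_mul, show (2 ^ 2 : ℕ) = 4 by norm_num] at hm
    rw [pow_succ] at hR hm
    have h2 : 2 ∣ m := by
      have : 2 ∣ m ^ 2 := by
        rw [← hm]
        exact ⟨4 ^ n * 2 + 2 * R ^ 2, by ring⟩
      exact Nat.prime_two.dvd_of_dvd_pow this
    obtain ⟨t, rfl⟩ := h2
    have h3 : 4 ^ n + R ^ 2 = t ^ 2 := by nlinarith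
    have h4 : R < t := by nlinarith
    have h5 : 4 ^ n ≤ R := by omega
    nlinarith
  · rw [Nat.mul_div_cancel_left _ (by norm_num)] at hm
    have hp : 1 ≤ 4 ^ k := Nat.one_le_pow _ _ (by norm_num)
    have hdv := fun i => aux_dvd k i (by omega)
    obtain ⟨A, hA⟩ : ∃ A, A = 4 ^ k - 1 := ⟨_, rfl⟩
    rw [← hA] at hm hdv
    have h9 : 0 < 3 ^ k := by positivity
    have hlt : A < m := by nlinarith
    obtain ⟨e, rfl⟩ : ∃ e, m = A + e := ⟨m - A, by omega⟩
    have hprod : e * (e + 2 * A) = 3 ^ (k * 2) := by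
      rw [pow_mul]; nlinarith
    obtain ⟨i, -, hi⟩ := (Nat.dvd_prime_pow Nat.prime_three).1 (Dvd.intro _ hprod)
    obtain ⟨j, -, hj⟩ := (Nat.dvd_prime_pow Nat.prime_three).1 (Dvd.intro_left _ hprod)
    have hij : i ≤ j := by
      rw [← Nat.pow_le_pow_iff_right (a := 3) (by norm_num), ← hi, ← hj]; omega
    have hd : 3 ^ i ∣ e + 2 * A := hj ▸ pow_dvd_pow 3 hij
    rw [← hi] at hd
    have hd2 : e ∣ 2 * A := (Nat.dvd_add_right dvd_rfl).1 hd
    have hd3 : e ∣ A := by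
      refine Nat.Coprime.dvd_of_dvd_mul_left ?_ hd2
      rw [hi]
      exact Nat.Coprime.pow_left _ (by norm_num)
    have hle : e ≤ 3 * k := by
      refine Nat.le_of_dvd (by omega) ?_
      rw [hi] at hd3 ⊢
      exact hdv i hd3
    by_cases h4 : 4 ≤ k
    · have hg := aux_growth k h4
      have hm2 : e * (e + 2 * A) ≤ 3 * k * (3 * k + 2 * 4 ^ k) :=
        Nat.mul_le_mul hle (by omega)
      rw [hprod, mul_comm, pow_mul] at hm2
      norm_num at hm2
      omega
    · obtain rfl | rfl : k = 2 ∨ k = 3 := by omega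
      · norm_num at hA hprod hle
        subst hA
        interval_cases e <;> omega
      · norm_num at hA hprod hle
        subst hA
        interval_cases e <;> omega
end

section
/- For every integer k ≥ 2, the number (2^k)^2 + (3^k − 1)^2 is not a perfect square; i.e., there is no Pythagorean triangle whose two legs have lengths 2^k and 3^k − 1. -/
/-- Theorem 3 (base 3, Type 2): for `k ≥ 2`, the number `(2^k)^2 + (3^k − 1)^2`
is not a perfect square. -/
theorem no_type2_base3 (k : ℕ) (hk : 2 ≤ k) :
    ¬ ∃ m : ℕ, (2 ^ k) ^ 2 + (3 ^ k - 1) ^ 2 = m ^ 2 := by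
  rintro ⟨m, h⟩
  have h1 : ((2 ^ k) ^ 2) % 3 = 1 := by
    rw [← pow_mul, mul_comm, pow_mul, Nat.pow_mod]
    norm_num
  have h2 : (3 ^ k - 1) % 3 = 2 := by
    obtain ⟨n, rfl⟩ : ∃ n, k = n + 1 := ⟨k - 1, by omega⟩
    have : 0 < 3 ^ n := by positivity
    rw [pow_succ]
    omega
  have h3 : ((3 ^ k - 1) ^ 2) % 3 = 1 := by
    rw [Nat.pow_mod, h2]
  have h4 : m ^ 2 % 3 = 0 ∨ m ^ 2 % 3 = 1 := by
    have : m % 3 = 0 ∨ m % 3 = 1 ∨ m % 3 = 2 := by omega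
    rcases this with h | h | h <;> simp [Nat.pow_mod, h]
  omega
end

section
/- Let d and b be positive integers with 2 ≤ d ≤ 4 and d ≤ b − 1. Then (d·(b+1))^2 + (d^2)^2 is not a perfect square; i.e., there is no Pythagorean triangle whose two legs have lengths d_{2,b} = d·(b+1) and d^2. -/
/-- Theorem 5: for positive integers `d`, `b` with `2 ≤ d ≤ 4` and `d ≤ b − 1`,
the number `(d·(b+1))^2 + (d^2)^2` is not a perfect square. -/
theorem no_type2_k2_small_digit (d b : ℕ) (hb : 0 < b) (hd2 : 2 ≤ d) (hd4 : d ≤ 4)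
    (hdb : d ≤ b - 1) :
    ¬ ∃ m : ℕ, (d * (b + 1)) ^ 2 + (d ^ 2) ^ 2 = m ^ 2 := by
  rintro ⟨m, hm⟩
  have hdvd : d ∣ m := by
    have h : d ^ 2 ∣ m ^ 2 := ⟨(b + 1) ^ 2 + d ^ 2, by rw [← hm]; ring⟩
    exact (Nat.pow_dvd_pow_iff (by norm_num)).1 h
  obtain ⟨k, rfl⟩ := hdvd
  have hk : (b + 1) ^ 2 + d ^ 2 = k ^ 2 := by
    have hpos : 0 < d ^ 2 := by positivity
    apply Nat.eq_of_mul_eq_mul_left hpos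
    linarith [hm, mul_pow d k 2, mul_pow d (b + 1) 2, show (d ^ 2) ^ 2 = d ^ 2 * d ^ 2 by ring]
  have hkb : b + 2 ≤ k := by
    by_contra h
    have : k ≤ b + 1 := by omega
    nlinarith
  have hb6 : b ≤ 6 := by nlinarith
  have hk9 : k ≤ 9 := by nlinarith
  have hb3 : d + 1 ≤ b := by omega
  clear hm hdb
  interval_cases d <;> interval_cases b <;> interval_cases k <;> omega
end

section
/- Let ℓ and q be positive integers with ℓ^2 ≤ 2q^2 − 2, and set r = q + ℓ, b = 2rq − 1, and d = r^2 − q^2. Then 2 ≤ d ≤ b − 1, b ≥ 3, and (d·(b+1))^2 + (d^2)^2 is a perfect square; i.e., the Type 2 triangle T_2(2,b,d) exists. -/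
/-- Family F₁: for positive integers `ℓ`, `q` with `ℓ^2 ≤ 2q^2 − 2`, setting
`r = q + ℓ`, `b = 2rq − 1`, `d = r^2 − q^2`, we get `2 ≤ d ≤ b − 1`, `b ≥ 3`,
and `(d·(b+1))^2 + (d^2)^2` is a perfect square. -/
theorem family_F1 (ℓ q r b d : ℕ) (hℓ : 0 < ℓ) (hq : 0 < q)
    (h : ℓ ^ 2 ≤ 2 * q ^ 2 - 2) (hr : r = q + ℓ) (hb : b = 2 * r * q - 1)
    (hd : d = r ^ 2 - q ^ 2) :
    2 ≤ d ∧ d ≤ b - 1 ∧ 3 ≤ b ∧ ∃ m : ℕ, (d * (b + 1)) ^ 2 + (d ^ 2) ^ 2 = m ^ 2 := by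
  have hd' : d = 2 * (q * ℓ) + ℓ ^ 2 := by
    rw [hd, hr]
    apply Nat.sub_eq_of_eq_add
    ring
  have e : 2 * r * q = 2 * q ^ 2 + 2 * (q * ℓ) := by rw [hr]; ring
  have h1 : 0 < ℓ ^ 2 := by positivity
  have h2 : 0 < q * ℓ := by positivity
  have hb' : b + 1 = 2 * q ^ 2 + 2 * (q * ℓ) := by omega
  refine ⟨by omega, by omega, by omega, d * (r ^ 2 + q ^ 2), ?_⟩
  rw [hb', hd', hr]
  ring
end

section
/- Let ℓ and q be positive integers with ℓ^2 ≥ 2q^2 + 2, and set r = q + ℓ, b = r^2 − q^2 − 1, and d = 2rq. Then 2 ≤ d ≤ b − 1, b ≥ 4, and (d·(b+1))^2 + (d^2)^2 is a perfect square; i.e., the Type 2 triangle T_2(2,b,d) exists. -/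
/-- Family F₂: for positive integers `ℓ`, `q` with `ℓ^2 ≥ 2q^2 + 2`, setting
`r = q + ℓ`, `b = r^2 − q^2 − 1`, `d = 2rq`, we get `2 ≤ d ≤ b − 1`, `b ≥ 4`,
and `(d·(b+1))^2 + (d^2)^2` is a perfect square. -/
theorem family_F2 (ℓ q r b d : ℕ) (hℓ : 0 < ℓ) (hq : 0 < q)
    (h : 2 * q ^ 2 + 2 ≤ ℓ ^ 2) (hr : r = q + ℓ) (hb : b = r ^ 2 - q ^ 2 - 1)
    (hd : d = 2 * r * q) :
    2 ≤ d ∧ d ≤ b - 1 ∧ 4 ≤ b ∧ ∃ m : ℕ, (d * (b + 1)) ^ 2 + (d ^ 2) ^ 2 = m ^ 2 := by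
  have hrr : r ^ 2 = q ^ 2 + (2 * (q * ℓ) + ℓ ^ 2) := by rw [hr]; ring
  have hdd : d = 2 * q ^ 2 + 2 * (q * ℓ) := by rw [hd, hr]; ring
  have h1 : 0 < q * ℓ := Nat.mul_pos hq hℓ
  have h2 : 0 < q ^ 2 := by positivity
  have hb1 : b + 1 = 2 * (q * ℓ) + ℓ ^ 2 := by omega
  refine ⟨by omega, by omega, by omega, d * (r ^ 2 + q ^ 2), ?_⟩
  rw [hb1, hrr, hdd]
  ring
end

section
/- Let r > q ≥ 1 be integers, and set b = r^2 + q^2 − 1 and d = r^2 − q^2. Then 3 ≤ d ≤ b − 1 and (d·(b+1))^2 − (d^2)^2 is a perfect square of a positive integer; i.e., the Type 1 triangle T_1(2,b,d) exists. -/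
/-- Family S₁: for integers `r > q ≥ 1`, setting `b = r^2 + q^2 − 1` and
`d = r^2 − q^2`, we get `3 ≤ d ≤ b − 1` and `(d·(b+1))^2 − (d^2)^2` is the
square of a positive integer. -/
theorem family_S1 (r q b d : ℕ) (hq : 1 ≤ q) (hrq : q < r)
    (hb : b = r ^ 2 + q ^ 2 - 1) (hd : d = r ^ 2 - q ^ 2) :
    3 ≤ d ∧ d ≤ b - 1 ∧ ∃ x : ℕ, 0 < x ∧ (d * (b + 1)) ^ 2 - (d ^ 2) ^ 2 = x ^ 2 := by
  have hq2 : 1 ≤ q ^ 2 := Nat.one_le_pow _ _ hq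
  have hr2 : q ^ 2 + 3 ≤ r ^ 2 := by nlinarith
  have hd3 : 3 ≤ d := by omega
  refine ⟨hd3, by omega, 2 * d * r * q, ?_, ?_⟩
  · have hr : 0 < r := by omega
    have hd0 : 0 < d := by omega
    positivity
  · have hb1 : b + 1 = r ^ 2 + q ^ 2 := by omega
    have hdr : r ^ 2 = d + q ^ 2 := by omega
    have key : (d * (b + 1)) ^ 2 = (2 * d * r * q) ^ 2 + (d ^ 2) ^ 2 := by
      have e : (2 * d * r * q) ^ 2 = 4 * d ^ 2 * r ^ 2 * q ^ 2 := by ring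
      rw [hb1, e, hdr]
      ring
    rw [key, Nat.add_sub_cancel]
end

section
/- Let r and q be positive integers with r ≥ q + 2, and set b = r^2 + q^2 − 1 and d = 2rq. Then 2 ≤ d ≤ b − 3 < b − 1 and (d·(b+1))^2 − (d^2)^2 is a perfect square of a positive integer; i.e., the Type 1 triangle T_1(2,b,d) exists. -/
/-- Family S₂: for positive integers `r`, `q` with `r ≥ q + 2`, setting
`b = r^2 + q^2 − 1` and `d = 2rq`, we get `2 ≤ d ≤ b − 3 < b − 1` and
`(d·(b+1))^2 − (d^2)^2` is the square of a positive integer. -/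
theorem family_S2 (r q b d : ℕ) (hq : 0 < q) (hrq : q + 2 ≤ r)
    (hb : b = r ^ 2 + q ^ 2 - 1) (hd : d = 2 * r * q) :
    2 ≤ d ∧ d ≤ b - 3 ∧ b - 3 < b - 1 ∧
      ∃ x : ℕ, 0 < x ∧ (d * (b + 1)) ^ 2 - (d ^ 2) ^ 2 = x ^ 2 := by
  obtain ⟨k, rfl⟩ := Nat.exists_eq_add_of_le hrq
  have hb1 : b + 1 = d + (k + 2) ^ 2 := by
    have h1 : (q + 2 + k) ^ 2 + q ^ 2 = d + (k + 2) ^ 2 := by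
      rw [hd]; ring
    have h2 : 0 < (k + 2) ^ 2 := by positivity
    omega
  have hk : 4 ≤ (k + 2) ^ 2 := by nlinarith
  have hd2 : 2 ≤ d := by rw [hd]; nlinarith
  refine ⟨hd2, by omega, by omega, d * ((k + 2) * (2 * q + 2 + k)), by positivity, ?_⟩
  apply Nat.sub_eq_of_eq_add
  rw [hb1, hd]
  ring
end

section
/- For every odd integer d ≥ 3 there exists a positive integer b with d ≤ b − 1 such that (d·(b+1))^2 − (d^2)^2 is a perfect square of a positive integer; in fact one may take b = (d^2 − 1)/2. -/
/-- Corollary of Family S₁: for every odd `d ≥ 3` there is a positive integer `b`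
with `d ≤ b − 1` such that `(d·(b+1))^2 − (d^2)^2` is the square of a positive
integer; one may take `b = (d^2 − 1)/2`. -/
theorem corollary_S1 (d : ℕ) (hodd : Odd d) (hd : 3 ≤ d) :
    ∃ b : ℕ, 0 < b ∧ d ≤ b - 1 ∧ b = (d ^ 2 - 1) / 2 ∧
      ∃ x : ℕ, 0 < x ∧ (d * (b + 1)) ^ 2 - (d ^ 2) ^ 2 = x ^ 2 := by
  obtain ⟨k, rfl⟩ := hodd
  have hk : 1 ≤ k := by omega
  have hkk : k ≤ k * k := Nat.le_mul_self k
  have hb : 2 * (k * k) + 2 * k = ((2 * k + 1) ^ 2 - 1) / 2 := by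
    have h : (2 * k + 1) ^ 2 = 2 * (2 * (k * k) + 2 * k) + 1 := by ring
    omega
  refine ⟨2 * (k * k) + 2 * k, by omega, by omega, hb,
    (2 * k + 1) * (2 * (k * k) + 2 * k), ?_, ?_⟩
  · exact Nat.mul_pos (by omega) (by omega)
  · apply Nat.sub_eq_of_eq_add
    ring
end

section
/- For every even integer d ≥ 6 there exists a positive integer b with d ≤ b − 1 such that (d·(b+1))^2 − (d^2)^2 is a perfect square of a positive integer; in fact one may take b = d^2/4. -/
/-- Corollary of Family S₂: for every even `d ≥ 6` there is a positive integer `b`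
with `d ≤ b − 1` such that `(d·(b+1))^2 − (d^2)^2` is the square of a positive
integer; one may take `b = d^2/4`. -/
theorem corollary_S2 (d : ℕ) (heven : Even d) (hd : 6 ≤ d) :
    ∃ b : ℕ, 0 < b ∧ d ≤ b - 1 ∧ b = d ^ 2 / 4 ∧
      ∃ x : ℕ, 0 < x ∧ (d * (b + 1)) ^ 2 - (d ^ 2) ^ 2 = x ^ 2 := by
  obtain ⟨k, rfl⟩ := heven
  obtain ⟨m, rfl⟩ : ∃ m, k = m + 3 := ⟨k - 3, by omega⟩
  refine ⟨(m + 3) ^ 2, by positivity, ?_, ?_, 2 * (m + 3) * ((m + 2) * (m + 4)), by positivity, ?_⟩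
  · apply Nat.le_sub_of_add_le
    nlinarith
  · have h : (m + 3 + (m + 3)) ^ 2 = 4 * (m + 3) ^ 2 := by ring
    omega
  · apply Nat.sub_eq_of_eq_add
    ring
end

section
/- For d = 2 and for d = 4, there is no positive integer b with d ≤ b − 1 such that (d·(b+1))^2 − (d^2)^2 is a perfect square of a positive integer; i.e., no Type 1 triangle T_1(2,b,2) or T_1(2,b,4) exists for any base b. -/
/-- For `d = 2` and `d = 4`, there is no positive integer `b` with `d ≤ b − 1`
such that `(d·(b+1))^2 − (d^2)^2` is the square of a positive integer. -/
theorem no_type1_k2_d2_d4 (d : ℕ) (hd : d = 2 ∨ d = 4) :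
    ¬ ∃ b : ℕ, 0 < b ∧ d ≤ b - 1 ∧
      ∃ x : ℕ, 0 < x ∧ (d * (b + 1)) ^ 2 - (d ^ 2) ^ 2 = x ^ 2 := by
  rintro ⟨b, hb, hdb, x, hx, h⟩
  have hdvd : d ∣ x := by
    rw [← Nat.pow_dvd_pow_iff (n := 2) (by norm_num), ← h]
    exact Nat.dvd_sub ⟨(b + 1) ^ 2, by ring⟩ ⟨d ^ 2, by ring⟩
  obtain ⟨y, rfl⟩ := hdvd
  have h2 : (d * (b + 1)) ^ 2 = (d * y) ^ 2 + (d ^ 2) ^ 2 := by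
    have : 0 < (d * y) ^ 2 := by positivity
    omega
  have h3 : (b + 1) ^ 2 = y ^ 2 + d ^ 2 := by
    rcases hd with rfl | rfl <;> nlinarith
  have hlt : y < b + 1 := by
    rcases hd with rfl | rfl <;> nlinarith
  obtain ⟨k, hk⟩ := Nat.exists_eq_add_of_lt hlt
  have hbk : b = y + k := by omega
  subst hbk
  rcases hd with rfl | rfl
  · have : 3 ≤ y + k := by omega
    nlinarith
  · have h5 : 5 ≤ y + k := by omega
    rcases k with _ | k
    · ring_nf at h3
      omega
    · nlinarith
end

section
/- For every odd integer d ≥ 5 there exists a positive integer b with d ≤ b − 1 such that (d·(b+1))^2 + (d^2)^2 is a perfect square; in fact one may take b = (d^2 − 3)/2. -/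
/-- Corollary of Family F₁: for every odd `d ≥ 5` there is a positive integer `b`
with `d ≤ b − 1` such that `(d·(b+1))^2 + (d^2)^2` is a perfect square; one may
take `b = (d^2 − 3)/2`. -/
theorem corollary_F1 (d : ℕ) (hodd : Odd d) (hd : 5 ≤ d) :
    ∃ b : ℕ, 0 < b ∧ d ≤ b - 1 ∧ b = (d ^ 2 - 3) / 2 ∧
      ∃ m : ℕ, (d * (b + 1)) ^ 2 + (d ^ 2) ^ 2 = m ^ 2 := by
  obtain ⟨k, rfl⟩ := hodd
  obtain ⟨j, rfl⟩ : ∃ j, k = j + 2 := ⟨k - 2, by omega⟩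
  have h : (2 * (j + 2) + 1) ^ 2 = 2 * (2 * j ^ 2 + 10 * j + 11) + 3 := by ring
  refine ⟨2 * j ^ 2 + 10 * j + 11, by omega, by omega, by omega,
    (2 * (j + 2) + 1) * (2 * j ^ 2 + 10 * j + 13), by ring⟩
end

section
/- For every even integer d ≥ 6 there exists a positive integer b with d ≤ b − 1 such that (d·(b+1))^2 + (d^2)^2 is a perfect square; in fact one may take b = (d^2 − 8)/4. -/
/-- Corollary of Family F₂: for every even `d ≥ 6` there is a positive integer `b`
with `d ≤ b − 1` such that `(d·(b+1))^2 + (d^2)^2` is a perfect square; one may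
take `b = (d^2 − 8)/4`. -/
theorem corollary_F2 (d : ℕ) (heven : Even d) (hd : 6 ≤ d) :
    ∃ b : ℕ, 0 < b ∧ d ≤ b - 1 ∧ b = (d ^ 2 - 8) / 4 ∧
      ∃ m : ℕ, (d * (b + 1)) ^ 2 + (d ^ 2) ^ 2 = m ^ 2 := by
  obtain ⟨k, rfl⟩ := heven
  obtain ⟨j, rfl⟩ : ∃ j, k = j + 3 := ⟨k - 3, by omega⟩
  have h : (j + 3 + (j + 3)) ^ 2 = 4 * (j ^ 2 + 6 * j + 7) + 8 := by ring
  refine ⟨j ^ 2 + 6 * j + 7, by omega, by omega, by omega,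
    2 * (j + 3) * ((j + 3) ^ 2 + 1), by ring⟩
end

section
/- Let v ≥ 0 and w ≥ 1 be integers, set k = v + w, and suppose k ≥ 2 and 2·(4^k − 1) = 3^v·(3^{2w} + 1). Then v = 1, w = 1, and k = 2. -/
/-- The exponential Diophantine equation from the proof of Theorem 2: if `v ≥ 0`,
`w ≥ 1`, `k = v + w ≥ 2` and `2·(4^k − 1) = 3^v·(3^{2w} + 1)`, then `v = 1`,
`w = 1`, and `k = 2`. -/
theorem base4_type1_diophantine (v w k : ℕ) (hw : 1 ≤ w) (hk : k = v + w)
    (hk2 : 2 ≤ k) (h : 2 * (4 ^ k - 1) = 3 ^ v * (3 ^ (2 * w) + 1)) :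
    v = 1 ∧ w = 1 ∧ k = 2 := by
  have hk0 : k ≠ 0 := by omega
  have hpos : 1 ≤ 4 ^ k := Nat.one_le_pow _ _ (by norm_num)
  have hlt : 1 < 4 ^ k := Nat.one_lt_pow hk0 (by norm_num)
  -- `3 ^ v` divides `4 ^ k - 1`
  have hd : 3 ^ v ∣ 4 ^ k - 1 := by
    have h1 : 3 ^ v ∣ 2 * (4 ^ k - 1) := ⟨_, h⟩
    exact Nat.Coprime.dvd_of_dvd_mul_left (Nat.Coprime.pow_left v (by norm_num)) h1
  -- lifting the exponent
  haveI : Fact (Nat.Prime 3) := ⟨Nat.prime_three⟩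
  have hlte : padicValNat 3 (4 ^ k - 1 ^ k) = padicValNat 3 (4 - 1) + padicValNat 3 k :=
    padicValNat.pow_sub_pow (by decide) (by norm_num) (by norm_num) (by norm_num) hk0
  have hv : v ≤ padicValNat 3 (4 ^ k - 1) :=
    (padicValNat_dvd_iff_le (by omega)).1 hd
  have h3 : padicValNat 3 (4 - 1) = 1 := by norm_num
  rw [one_pow, h3] at hlte
  have hle : 3 ^ v ≤ 3 * k := by
    have h1 : 3 ^ padicValNat 3 k ≤ k := Nat.le_of_dvd (by omega) pow_padicValNat_dvd
    calc 3 ^ v ≤ 3 ^ (1 + padicValNat 3 k) := Nat.pow_le_pow_right (by norm_num) (by omega)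
      _ = 3 * 3 ^ padicValNat 3 k := by rw [pow_add, pow_one]
      _ ≤ 3 * k := by omega
  -- size comparison
  have hsize : 9 ^ k ≤ 6 * k * 4 ^ k := by
    have e : 9 ^ k = 3 ^ v * (3 ^ v * 3 ^ (2 * w)) := by
      rw [show (9 : ℕ) = 3 ^ 2 by norm_num, ← pow_mul, ← pow_add, ← pow_add, hk]
      congr 1
      ring
    have h1 : 3 ^ v * 3 ^ (2 * w) ≤ 2 * 4 ^ k := by
      rw [mul_add] at h
      omega
    calc 9 ^ k = 3 ^ v * (3 ^ v * 3 ^ (2 * w)) := e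
      _ ≤ (3 * k) * (2 * 4 ^ k) := Nat.mul_le_mul hle h1
      _ = 6 * k * 4 ^ k := by ring
  have hk4 : k < 4 := by
    by_contra hcon
    have hbig : ∀ n : ℕ, 4 ≤ n → 6 * n * 4 ^ n < 9 ^ n := by
      intro n hn
      induction n, hn using Nat.le_induction with
      | base => norm_num
      | succ n hn ih =>
        have hp : 0 < 4 ^ n := by positivity
        rw [pow_succ, pow_succ]
        nlinarith
    exact absurd hsize (not_le.2 (hbig k (by omega)))
  have hvle : v ≤ 2 := by omega
  have hw3 : w ≤ 3 := by omega
  subst hk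
  interval_cases v <;> interval_cases w <;> simp_all
end

section
/- There are no integers k ≥ 2, p ≥ 0, and v ≥ 1 satisfying 3^k − 1 = 2^p·(2^{2v} − 1). -/
/-- The exponential Diophantine equation from the proof of Theorem 3: there are no
integers `k ≥ 2`, `p ≥ 0`, `v ≥ 1` with `3^k − 1 = 2^p·(2^{2v} − 1)`. -/
theorem base3_type2_diophantine :
    ¬ ∃ (k p v : ℕ), 2 ≤ k ∧ 1 ≤ v ∧ 3 ^ k - 1 = 2 ^ p * (2 ^ (2 * v) - 1) := by
  rintro ⟨k, p, v, hk, hv, h⟩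
  have h3 : 3 ∣ 2 ^ (2 * v) - 1 := by
    have := Nat.sub_dvd_pow_sub_pow 4 1 v
    rw [pow_mul]
    simpa using this
  have h4 : 3 ∣ 3 ^ k - 1 := h ▸ Dvd.dvd.mul_left h3 _
  have h5 : 3 ∣ 3 ^ k := dvd_pow_self 3 (by omega)
  have h6 : 0 < 3 ^ k := by positivity
  omega
end

section
/- There are no integers p ≥ 0 and v ≥ 1 satisfying 3^{p+v+1} − 1 = 2^p·(2^{2v} + 1). -/
lemma aux_mod64 (k : ℕ) (h : 3 ^ k % 64 = 1) : k % 16 = 0 := by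
  have h1 : 3 ^ k % 64 = 3 ^ (k % 16) % 64 := by
    conv_lhs => rw [← Nat.div_add_mod k 16, pow_add, pow_mul]
    rw [Nat.mul_mod, Nat.pow_mod]
    norm_num
  rw [h1] at h
  have h2 : k % 16 < 16 := Nat.mod_lt _ (by norm_num)
  generalize k % 16 = r at *
  interval_cases r <;> simp_all

lemma aux_mod17 (k : ℕ) (h : k % 16 = 0) : 3 ^ k % 17 = 1 := by
  obtain ⟨j, rfl⟩ := Nat.dvd_of_mod_eq_zero h
  rw [pow_mul, Nat.pow_mod]
  norm_num

lemma aux_four17 (j : ℕ) : 4 ^ (2 * j + 1) % 17 = 4 ∨ 4 ^ (2 * j + 1) % 17 = 13 := by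
  induction j with
  | zero => simp
  | succ n ih =>
    have : 4 ^ (2 * (n + 1) + 1) = 16 * 4 ^ (2 * n + 1) := by ring
    omega

lemma aux_mod8 (k : ℕ) : 3 ^ k % 8 = 1 ∨ 3 ^ k % 8 = 3 := by
  induction k with
  | zero => simp
  | succ n ih => rw [pow_succ]; omega

lemma aux_four3 (k : ℕ) : 4 ^ k % 3 = 1 := by
  rw [Nat.pow_mod]; norm_num

lemma aux_size (n : ℕ) : 243 * 3 ^ (n + 10) < 16 * 4 ^ (n + 10) := by
  induction n with
  | zero => norm_num
  | succ n ih =>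
    have h1 : 3 ^ (n + 1 + 10) = 3 * 3 ^ (n + 10) := by ring
    have h2 : 4 ^ (n + 1 + 10) = 4 * 4 ^ (n + 10) := by ring
    omega

/-- The exponential Diophantine equation from the proof of Theorem 4: there are no
integers `p ≥ 0` and `v ≥ 1` with `3^{p+v+1} − 1 = 2^p·(2^{2v} + 1)`. -/
theorem base3_type1_diophantine :
    ¬ ∃ (p v : ℕ), 1 ≤ v ∧ 3 ^ (p + v + 1) - 1 = 2 ^ p * (2 ^ (2 * v) + 1) := by
  rintro ⟨p, v, hv, h⟩
  have hpos : 0 < 3 ^ (p + v + 1) := by positivity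
  have h4 : 2 ^ (2 * v) = 4 ^ v := by rw [pow_mul]; norm_num
  rw [h4] at h
  have h : 3 ^ (p + v + 1) = 2 ^ p * (4 ^ v + 1) + 1 := by omega
  clear hpos h4
  have h3 := aux_four3 v
  -- p is even
  obtain ⟨q, rfl | rfl⟩ := Nat.even_or_odd' p
  swap
  · have e1 : 3 ^ (2 * q + 1 + v + 1) = 3 * 3 ^ (2 * q + 1 + v) := by ring
    have e2 : 2 ^ (2 * q + 1) = 2 * 4 ^ q := by rw [pow_succ, pow_mul]; norm_num [mul_comm]
    have h3q := aux_four3 q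
    have : (2 * 4 ^ q * (4 ^ v + 1) + 1) % 3 = 2 := by
      simp [Nat.add_mod, Nat.mul_mod, h3, h3q]
    rw [e1, e2] at h
    omega
  rcases Nat.lt_or_ge q 3 with hq | hq
  · have h8 := aux_mod8 (2 * q + v + 1)
    obtain ⟨w, rfl⟩ : ∃ w, v = w + 1 := ⟨v - 1, by omega⟩
    have e : 4 ^ (w + 1) = 4 * 4 ^ w := by ring
    interval_cases q
    · omega
    · omega
    · rcases Nat.lt_or_ge w 9 with hw | hw
      · interval_cases w <;> norm_num at h
      · obtain ⟨n, rfl⟩ := Nat.exists_eq_add_of_le' hw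
        have := aux_size n
        have e3 : 3 ^ (2 * 2 + (n + 9 + 1) + 1) = 243 * 3 ^ (n + 10) := by ring
        have e4 : 4 ^ (n + 9 + 1) = 4 ^ (n + 10) := rfl
        omega
  · obtain ⟨r, rfl⟩ := Nat.exists_eq_add_of_le hq
    have e : 2 ^ (2 * (3 + r)) * (4 ^ v + 1) = 64 * (2 ^ (2 * r) * (4 ^ v + 1)) := by ring
    have hk := aux_mod64 (2 * (3 + r) + v + 1) (by omega)
    have h17 := aux_mod17 _ hk
    have hd : 17 ∣ 2 ^ (2 * (3 + r)) * (4 ^ v + 1) := by omega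
    have hc : Nat.Coprime 17 (2 ^ (2 * (3 + r))) := Nat.Coprime.pow_right _ (by norm_num)
    have hd2 := hc.dvd_of_dvd_mul_left hd
    obtain ⟨j, rfl⟩ : ∃ j, v = 2 * j + 1 := ⟨v / 2, by omega⟩
    have := aux_four17 j
    omega
end
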